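/- Let ε > 0 be a real number and let m ≥ 2 be an integer. There exists n₀ such that for every n ≥ n₀ the sequence of integers Σ = (a_1, …, a_n) with a_i = ⌊(2+ε)^n − 2^{i−1}⌋ for i = 1, …, n satisfies e^m_Σ(A₁) ≠ e^m_Σ(A₂) for all distinct subsets A₁, A₂ ⊆ {1, …, n} with |A₁|, |A₂| ≥ m. -/

import Mathlib

/-- The `m`-th evaluation of the integer sequence `a` on the subset `A`:
the sum over all `m`-element subsets of `A` of the product of the entries.
It is `0` when `|A| < m`. -/
def mthEval (n m : ℕ) (a : Fin n → ℤ) (A : Finset (Fin n)) : ℤ :=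
  ∑ S ∈ A.powersetCard m, ∏ i ∈ S, a i

lemma mthEval_zero (n : ℕ) (a : Fin n → ℤ) (A : Finset (Fin n)) : mthEval n 0 a A = 1 := by
  simp [mthEval]

lemma newton_aux (n : ℕ) (b : Fin n → ℤ) (A : Finset (Fin n)) (k : ℕ) :
    (k : ℤ) * mthEval n k b A = (-1) ^ (k + 1) *
      ∑ x ∈ Finset.HasAntidiagonal.antidiagonal k with x.1 < k,
        (-1) ^ x.1 * mthEval n x.1 b A * ∑ i ∈ A, b i ^ x.2 := by
  have h := congrArg (MvPolynomial.aeval (fun i : A => b i)) (MvPolynomial.mul_esymm_eq_sum A ℤ k)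
  have he : ∀ k, MvPolynomial.aeval (fun i : A => b i) (MvPolynomial.esymm A ℤ k)
      = mthEval n k b A := by
    intro k
    rw [MvPolynomial.aeval_esymm_eq_multiset_esymm, mthEval, ← Finset.esymm_map_val]
    congr 1
    exact Multiset.attach_map_val' A.val b
  have hp : ∀ k, MvPolynomial.aeval (fun i : A => b i) (MvPolynomial.psum A ℤ k)
      = ∑ i ∈ A, b i ^ k := by
    intro k
    simp only [MvPolynomial.psum, map_sum, map_pow, MvPolynomial.aeval_X]
    exact Finset.sum_coe_sort A (fun i => b i ^ k)
  simpa [map_sum, map_mul, he, hp] using h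

lemma shift_aux (n m : ℕ) (b : Fin n → ℤ) (X : ℤ) (A : Finset (Fin n)) (hA : m ≤ A.card) :
    mthEval n m (fun i => X - b i) A = ∑ k ∈ Finset.range (m + 1),
      (-1) ^ k * X ^ (m - k) * ((A.card - k).choose (A.card - m) : ℤ) * mthEval n k b A := by
  have h1 := Multiset.prod_X_sub_X_eq_sum_esymm (A.val.map b)
  have h2 := Multiset.prod_X_add_C_coeff (A.val.map (fun i => X - b i)) (k := A.card - m) (by simp)
  have h3 := congrArg (fun p => (p.comp (Polynomial.X + Polynomial.C X)).coeff (A.card - m)) h1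
  simp only [Multiset.map_map, Multiset.card_map, Finset.card_val, Finset.esymm_map_val,
    Function.comp_def] at h2 h3
  rw [show A.card - (A.card - m) = m by omega] at h2
  have h4 : ((Multiset.map (fun x => Polynomial.X - Polynomial.C (b x)) A.val).prod).comp
      (Polynomial.X + Polynomial.C X) =
      (Multiset.map (fun x => Polynomial.X + Polynomial.C (X - b x)) A.val).prod := by
    rw [Polynomial.multiset_prod_comp, Multiset.map_map]
    congr 1
    refine Multiset.map_congr rfl fun x _ => ?_
    simp
    ring
  rw [h4, h2] at h3
  unfold mthEval
  rw [h3, Polynomial.sum_comp, Polynomial.finsetSum_coeff]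
  symm
  apply Finset.sum_subset_zero_on_sdiff
  · intro x; simp; omega
  · intro k hk
    simp only [Finset.mem_sdiff, Finset.mem_range] at hk
    have : ((-1 : Polynomial ℤ)) ^ k = Polynomial.C ((-1) ^ k) := by simp
    rw [this]
    simp only [Polynomial.mul_comp, Polynomial.C_comp, Polynomial.pow_comp, Polynomial.X_comp,
      Polynomial.coeff_C_mul, Polynomial.coeff_X_add_C_pow]
    rw [Nat.choose_eq_zero_of_lt (by omega)]
    simp
  · intro k hk
    simp only [Finset.mem_range] at hk
    have : ((-1 : Polynomial ℤ)) ^ k = Polynomial.C ((-1) ^ k) := by simp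
    rw [this]
    simp only [Polynomial.mul_comp, Polynomial.C_comp, Polynomial.pow_comp, Polynomial.X_comp,
      Polynomial.coeff_C_mul, Polynomial.coeff_X_add_C_pow]
    rw [show A.card - k - (A.card - m) = m - k by omega]
    ring

lemma geom_aux (n : ℕ) (r : ℤ) (hr : 2 ≤ r) (S : Finset (Fin n)) (j : ℕ)
    (hS : ∀ i ∈ S, (i : ℕ) < j) : (r - 1) * ∑ i ∈ S, r ^ (i : ℕ) ≤ r ^ j - 1 := by
  rw [← geom_sum_mul, mul_comm]
  refine mul_le_mul_of_nonneg_right ?_ (by linarith)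
  have : ∑ i ∈ S, r ^ (i : ℕ) = ∑ i ∈ S.map Fin.valEmbedding, r ^ i := by simp
  rw [this]
  refine Finset.sum_le_sum_of_subset_of_nonneg ?_ (fun i _ _ => by positivity)
  intro x hx
  simp only [Finset.mem_map, Fin.valEmbedding_apply] at hx
  obtain ⟨i, hi, rfl⟩ := hx
  simpa using hS i hi

lemma newton_sum (k : ℕ) (e p : ℕ → ℤ) :
    ∑ x ∈ Finset.HasAntidiagonal.antidiagonal k with x.1 < k, (-1) ^ x.1 * e x.1 * p x.2 =
    ∑ i ∈ Finset.range k, (-1) ^ i * e i * p (k - i) := by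
  rw [Finset.sum_filter, Finset.Nat.sum_antidiagonal_eq_sum_range_succ
    (fun i j => if i < k then (-1) ^ i * e i * p j else 0), Finset.sum_range_succ]
  simp only [lt_irrefl, if_false, add_zero]
  refine Finset.sum_congr rfl fun i hi => ?_
  rw [if_pos (by simpa using hi)]

lemma e_bound (e p : ℕ → ℤ) (N : ℤ) (hN : 0 ≤ N) (h0 : e 0 = 1)
    (hp : ∀ k, 1 ≤ k → |p k| ≤ N ^ k)
    (hn : ∀ k : ℕ, (k : ℤ) * e k = (-1) ^ (k + 1) *
      ∑ i ∈ Finset.range k, (-1) ^ i * e i * p (k - i)) (k : ℕ) : |e k| ≤ N ^ k := by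
  induction k using Nat.strong_induction_on with
  | _ k ih =>
    rcases Nat.eq_zero_or_pos k with rfl | hk
    · simp [h0]
    have h := congrArg abs (hn k)
    simp only [abs_mul, abs_pow, abs_neg, abs_one, one_pow, one_mul, Nat.abs_cast] at h
    have h2 : |∑ i ∈ Finset.range k, (-1) ^ i * e i * p (k - i)| ≤
        ∑ i ∈ Finset.range k, N ^ k := by
      refine (Finset.abs_sum_le_sum_abs _ _).trans (Finset.sum_le_sum fun i hi => ?_)
      have hi : i < k := by simpa using hi
      simp only [abs_mul, abs_pow, abs_neg, abs_one, one_pow, one_mul]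
      calc |e i| * |p (k - i)| ≤ N ^ i * N ^ (k - i) :=
            mul_le_mul (ih i hi) (hp _ (by omega)) (abs_nonneg _) (by positivity)
        _ = N ^ k := by rw [← pow_add]; congr 1; omega
    rw [← h] at h2
    simp only [Finset.sum_const, Finset.card_range, nsmul_eq_mul] at h2
    exact le_of_mul_le_mul_left h2 (by exact_mod_cast hk)

lemma e_diff (e p e' p' : ℕ → ℤ) (N Q : ℤ) (hN : 0 ≤ N) (hQ : 0 ≤ Q) (h0 : e 0 = 1) (h0' : e' 0 = 1)
    (hp : ∀ k, 1 ≤ k → |p k| ≤ N ^ k) (hp' : ∀ k, 1 ≤ k → |p' k| ≤ N ^ k)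
    (hn : ∀ k : ℕ, (k : ℤ) * e k = (-1) ^ (k + 1) *
      ∑ i ∈ Finset.range k, (-1) ^ i * e i * p (k - i))
    (hn' : ∀ k : ℕ, (k : ℤ) * e' k = (-1) ^ (k + 1) *
      ∑ i ∈ Finset.range k, (-1) ^ i * e' i * p' (k - i))
    (hd : ∀ k, 1 ≤ k → |p k - p' k| * N ^ 2 ≤ Q * N ^ k) (k : ℕ) :
    |e k - e' k| * N ^ 2 ≤ k * (Q * N ^ k) := by
  induction k using Nat.strong_induction_on with
  | _ k ih =>
    rcases Nat.eq_zero_or_pos k with rfl | hk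
    · simp [h0, h0']
    have hsub : (k : ℤ) * (e k - e' k) = (-1) ^ (k + 1) *
      ∑ i ∈ Finset.range k, (-1) ^ i * ((e i - e' i) * p (k - i) + e' i * (p (k - i) - p' (k - i))) := by
      rw [mul_sub, hn, hn', ← mul_sub, ← Finset.sum_sub_distrib]
      congr 1
      exact Finset.sum_congr rfl fun i _ => by ring
    have h := congrArg abs hsub
    simp only [abs_mul, abs_pow, abs_neg, abs_one, one_pow, one_mul, Nat.abs_cast] at h
    have h2 : |∑ i ∈ Finset.range k, (-1) ^ i * ((e i - e' i) * p (k - i) + e' i * (p (k - i) - p' (k - i)))| * N ^ 2 ≤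
        ∑ i ∈ Finset.range k, (k : ℤ) * (Q * N ^ k) := by
      refine (mul_le_mul_of_nonneg_right (Finset.abs_sum_le_sum_abs _ _) (by positivity)).trans ?_
      rw [Finset.sum_mul]
      refine Finset.sum_le_sum fun i hi => ?_
      have hi : i < k := by simpa using hi
      simp only [abs_mul, abs_pow, abs_neg, abs_one, one_pow, one_mul]
      have hNk : N ^ k = N ^ i * N ^ (k - i) := by rw [← pow_add]; congr 1; omega
      have t1 : |e i - e' i| * N ^ 2 * |p (k - i)| ≤ i * (Q * N ^ i) * N ^ (k - i) :=
        mul_le_mul (ih i hi) (hp _ (by omega)) (abs_nonneg _) (by positivity)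
      have t2 : |e' i| * (|p (k - i) - p' (k - i)| * N ^ 2) ≤ N ^ i * (Q * N ^ (k - i)) :=
        mul_le_mul (e_bound e' p' N hN h0' hp' hn' i) (hd _ (by omega)) (by positivity) (by positivity)
      have t3 := abs_add_le ((e i - e' i) * p (k - i)) (e' i * (p (k - i) - p' (k - i)))
      rw [abs_mul, abs_mul] at t3
      have t4 := mul_le_mul_of_nonneg_right t3 (by positivity : 0 ≤ N ^ 2)
      have t5 : ((i : ℤ) + 1) * (Q * N ^ k) ≤ k * (Q * N ^ k) :=
        mul_le_mul_of_nonneg_right (by exact_mod_cast hi) (by positivity)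
      rw [hNk] at t5 ⊢
      nlinarith
    rw [← h] at h2
    simp only [Finset.sum_const, Finset.card_range, nsmul_eq_mul] at h2
    rw [mul_assoc] at h2
    exact le_of_mul_le_mul_left h2 (by exact_mod_cast hk)

lemma card_case (n m : ℕ) (hm : 2 ≤ m) (X N : ℤ) (hN : 0 < N) (hX : n * N < X) (a : Fin n → ℤ)
    (ha1 : ∀ i, a i ≤ X) (ha2 : ∀ i, X - N ≤ a i) (A B : Finset (Fin n))
    (hA : m ≤ A.card) (hAB : A.card < B.card) : mthEval n m a A < mthEval n m a B := by
  have hBn : B.card ≤ n := by simpa using Finset.card_le_univ B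
  have hn1 : (1 : ℤ) ≤ n := by exact_mod_cast (by omega : 1 ≤ n)
  have hXN : 0 ≤ X - N := by nlinarith
  have hX0 : 0 < X := by linarith
  have h1 : mthEval n m a A ≤ A.card.choose m * X ^ m := by
    unfold mthEval
    rw [← Finset.card_powersetCard, ← nsmul_eq_mul]
    refine Finset.sum_le_card_nsmul _ _ _ fun S hS => ?_
    rw [← (Finset.mem_powersetCard.1 hS).2, ← Finset.prod_const]
    exact Finset.prod_le_prod (fun i _ => hXN.trans (ha2 i)) (fun i _ => ha1 i)
  have h2 : B.card.choose m * (X - N) ^ m ≤ mthEval n m a B := by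
    unfold mthEval
    rw [← Finset.card_powersetCard, ← nsmul_eq_mul]
    refine Finset.card_nsmul_le_sum _ _ _ fun S hS => ?_
    rw [← (Finset.mem_powersetCard.1 hS).2, ← Finset.prod_const]
    exact Finset.prod_le_prod (fun i _ => hXN) (fun i _ => ha2 i)
  obtain ⟨q, rfl⟩ : ∃ q, m = q + 1 := ⟨m - 1, by omega⟩
  have h3 : ∀ q : ℕ, X ^ (q + 1) - (q + 1) * N * X ^ q ≤ (X - N) ^ (q + 1) := by
    intro q
    induction q with
    | zero => simp
    | succ q ih =>
      have := mul_le_mul_of_nonneg_right ih hXN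
      have h' : 0 ≤ ((q : ℤ) + 1) * N * X ^ q * N := by positivity
      push_cast
      rw [pow_succ (X - N) (q + 1)]
      refine le_trans ?_ this
      ring_nf at h' ⊢
      nlinarith
  have h3 := h3 q
  set s := A.card with hs
  have h4 : ((s + 1).choose (q + 1) : ℤ) ≤ B.card.choose (q + 1) := by
    exact_mod_cast Nat.choose_le_choose (q + 1) hAB
  have h5 : ((s + 1).choose (q + 1) : ℤ) = s.choose q + s.choose (q + 1) := by
    exact_mod_cast Nat.choose_succ_succ s q
  have h6 : ((s : ℤ) + 1) * s.choose q = (s + 1).choose (q + 1) * (q + 1) := by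
    exact_mod_cast Nat.add_one_mul_choose_eq s q
  have h7 : (0 : ℤ) < s.choose q := by exact_mod_cast Nat.choose_pos (by omega)
  have h8 : ((s : ℤ) + 1) * N < X := by
    refine lt_of_le_of_lt (mul_le_mul_of_nonneg_right ?_ hN.le) hX
    exact_mod_cast (by omega : s + 1 ≤ n)
  have h9 : ((s + 1).choose (q + 1) : ℤ) * (X - N) ^ (q + 1) ≤ B.card.choose (q + 1) * (X - N) ^ (q + 1) :=
    mul_le_mul_of_nonneg_right h4 (by positivity)
  have h10 : ((s + 1).choose (q + 1) : ℤ) * (X ^ (q + 1) - (q + 1) * N * X ^ q) ≤ ((s + 1).choose (q + 1) : ℤ) * (X - N) ^ (q + 1) :=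
    mul_le_mul_of_nonneg_left h3 (by positivity)
  have h11 : ((s + 1).choose (q + 1) : ℤ) * (X ^ (q + 1) - (q + 1) * N * X ^ q)
      = (s.choose (q + 1) : ℤ) * X ^ (q + 1) + s.choose q * X ^ q * (X - (s + 1) * N) := by
    have : ((s + 1).choose (q + 1) : ℤ) * (X ^ (q + 1) - (q + 1) * N * X ^ q)
      = ((s + 1).choose (q + 1) : ℤ) * X ^ (q + 1) - ((s + 1).choose (q + 1) * (q + 1)) * N * X ^ q := by ring
    rw [this, ← h6, h5]; ring
  have h12 : 0 < (s.choose q : ℤ) * X ^ q * (X - (s + 1) * N) := by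
    have : 0 < X - (s + 1) * N := by linarith
    positivity
  linarith

lemma final_aux (X Y N D W P F C1 C2 T d : ℤ) (hY : 0 < Y) (hN : 0 < N) (hD : 1 ≤ D) (hC2 : 0 < C2)
    (hC : C2 ≤ C1) (hX : 2 * N ≤ X) (hW : W ≤ 2 * N) (hP : F ≤ 2 * P) (hd : 2 * d = D * W - P)
    (hT : 8 * T ≤ C2 * (D * N + 2 * F) * Y) : T + Y * C2 * d - Y * X * C1 * D < 0 := by
  have h1 : D * W ≤ D * (2 * N) := mul_le_mul_of_nonneg_left hW (by linarith)
  have h2 : Y * C2 * (4 * d) ≤ Y * C2 * (4 * (D * N) - F) := by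
    refine mul_le_mul_of_nonneg_left (by linarith) (by positivity)
  have h3 : C2 * (2 * N) ≤ C1 * X := mul_le_mul hC hX (by linarith) (by linarith)
  have h4 : Y * D * (C2 * (2 * N)) ≤ Y * D * (C1 * X) :=
    mul_le_mul_of_nonneg_left h3 (by positivity)
  have h5 : 0 < Y * D * C2 * N := by positivity
  linarith


lemma dp_aux (n : ℕ) (A B : Finset (Fin n)) (j : Fin n) (hjA : j ∈ A) (hjB : j ∉ B)
    (hj : ∀ i, j < i → (i ∈ A ↔ i ∈ B)) (r : ℤ) (hr : 2 ≤ r) :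
    (r - 2) * r ^ (j : ℕ) + 1 ≤ (r - 1) * (∑ i ∈ A, r ^ (i : ℕ) - ∑ i ∈ B, r ^ (i : ℕ)) ∧
    |∑ i ∈ A, r ^ (i : ℕ) - ∑ i ∈ B, r ^ (i : ℕ)| ≤ 2 * r ^ (j : ℕ) := by
  have h1 : ∑ i ∈ A, r ^ (i : ℕ) - ∑ i ∈ B, r ^ (i : ℕ) =
      r ^ (j : ℕ) + ∑ i ∈ (A \ B).erase j, r ^ (i : ℕ) - ∑ i ∈ B \ A, r ^ (i : ℕ) := by
    rw [Finset.add_sum_erase (A \ B) (fun i => r ^ (i : ℕ)) (by simp [hjA, hjB])]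
    exact (Finset.sum_sdiff_sub_sum_sdiff (s₁ := B) (s₂ := A)).symm
  have hlt : ∀ i, i ≠ j → ¬ (i ∈ A ↔ i ∈ B) → (i : ℕ) < j := by
    intro i hi h
    by_contra hc
    exact h (hj i (lt_of_le_of_ne (not_lt.1 (fun h => hc h)) (Ne.symm hi)))
  have h2 := geom_aux n r hr ((A \ B).erase j) j (by
    intro i hi
    simp only [Finset.mem_erase, Finset.mem_sdiff] at hi
    exact hlt i hi.1 (by tauto))
  have h3 := geom_aux n r hr (B \ A) j (by
    intro i hi
    simp only [Finset.mem_sdiff] at hi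
    exact hlt i (by rintro rfl; exact hjB hi.1) (by tauto))
  have h4 : 0 ≤ ∑ i ∈ (A \ B).erase j, r ^ (i : ℕ) := Finset.sum_nonneg fun i _ => by positivity
  have h5 : 0 ≤ ∑ i ∈ B \ A, r ^ (i : ℕ) := Finset.sum_nonneg fun i _ => by positivity
  have h6 : 0 ≤ r ^ (j : ℕ) := by positivity
  rw [h1]
  generalize ∑ i ∈ (A \ B).erase j, r ^ (i : ℕ) = U at *
  generalize ∑ i ∈ B \ A, r ^ (i : ℕ) = V at *
  generalize r ^ (j : ℕ) = R at *
  refine ⟨by nlinarith, ?_⟩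
  rw [abs_le]
  constructor <;> nlinarith

set_option maxHeartbeats 1000000 in
lemma same_card (n m : ℕ) (hm : 2 ≤ m) (X : ℤ) (hX : 8 * (m : ℤ) ^ 2 * 2 ^ n ≤ X)
    (A B : Finset (Fin n)) (hA : m ≤ A.card) (hAB : A.card = B.card)
    (j : Fin n) (hjA : j ∈ A) (hjB : j ∉ B) (hj : ∀ i, j < i → (i ∈ A ↔ i ∈ B)) :
    mthEval n m (fun i => X - 2 ^ (i : ℕ)) A < mthEval n m (fun i => X - 2 ^ (i : ℕ)) B := by
  set b : Fin n → ℤ := fun i => 2 ^ (i : ℕ) with hb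
  have hpow : ∀ (S : Finset (Fin n)) (k : ℕ), ∑ i ∈ S, b i ^ k = ∑ i ∈ S, ((2 : ℤ) ^ k) ^ (i : ℕ) := by
    intro S k
    refine Finset.sum_congr rfl fun i _ => ?_
    simp only [hb]
    rw [← pow_mul, ← pow_mul, mul_comm]
  set N : ℤ := 2 ^ n with hNdef
  have hN : 0 < N := by positivity
  have hk2 : ∀ k : ℕ, 1 ≤ k → (2 : ℤ) ≤ 2 ^ k := fun k hk => by
    calc (2 : ℤ) = 2 ^ 1 := by norm_num
      _ ≤ 2 ^ k := pow_le_pow_right₀ (by norm_num) hk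
  have hp : ∀ (S : Finset (Fin n)) (k : ℕ), 1 ≤ k → |∑ i ∈ S, b i ^ k| ≤ N ^ k := by
    intro S k hk
    rw [hpow, abs_of_nonneg (Finset.sum_nonneg fun i _ => by positivity)]
    have h1 := geom_aux n (2 ^ k) (hk2 k hk) S n (fun i _ => i.2)
    have h2 : 0 ≤ ∑ i ∈ S, ((2 : ℤ) ^ k) ^ (i : ℕ) := Finset.sum_nonneg fun i _ => by positivity
    have h3 : ((2 : ℤ) ^ k) ^ n = N ^ k := by rw [hNdef, ← pow_mul, ← pow_mul, mul_comm]
    rw [h3] at h1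
    nlinarith [hk2 k hk]
  have hn : ∀ (S : Finset (Fin n)) (k : ℕ), (k : ℤ) * mthEval n k b S = (-1) ^ (k + 1) *
      ∑ i ∈ Finset.range k, (-1) ^ i * mthEval n i b S * ∑ l ∈ S, b l ^ (k - i) := by
    intro S k
    rw [newton_aux, newton_sum k (fun i => mthEval n i b S) (fun i => ∑ l ∈ S, b l ^ i)]
  obtain ⟨D, hD⟩ : ∃ D, D = ∑ i ∈ A, b i ^ 1 - ∑ i ∈ B, b i ^ 1 := ⟨_, rfl⟩
  obtain ⟨P, hP⟩ : ∃ P, P = ∑ i ∈ A, b i ^ 2 - ∑ i ∈ B, b i ^ 2 := ⟨_, rfl⟩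
  obtain ⟨F, hF⟩ : ∃ F : ℤ, F = 4 ^ (j : ℕ) := ⟨_, rfl⟩
  have hF0 : 0 < F := by rw [hF]; positivity
  have hD1 : 1 ≤ D := by
    have := (dp_aux n A B j hjA hjB hj (2 ^ 1) (by norm_num)).1
    rw [← hpow, ← hpow, ← hD] at this
    linarith
  have hP1 : F ≤ 2 * P := by
    have := (dp_aux n A B j hjA hjB hj (2 ^ 2) (by norm_num)).1
    rw [← hpow, ← hpow, ← hP, show (2 : ℤ) ^ 2 = 4 by norm_num, ← hF] at this
    linarith
  have hQ0 : 0 ≤ D * N + 2 * F := by positivity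
  have hd : ∀ k, 1 ≤ k → |∑ i ∈ A, b i ^ k - ∑ i ∈ B, b i ^ k| * N ^ 2 ≤ (D * N + 2 * F) * N ^ k := by
    intro k hk
    rcases Nat.lt_or_ge k 2 with h | h
    · obtain rfl : k = 1 := by omega
      rw [← hD, abs_of_nonneg (by linarith)]
      nlinarith
    · obtain ⟨l, rfl⟩ : ∃ l, k = l + 2 := ⟨k - 2, by omega⟩
      have h1 := (dp_aux n A B j hjA hjB hj (2 ^ (l + 2)) (hk2 _ hk)).2
      rw [← hpow, ← hpow] at h1
      have h2 : ((2 : ℤ) ^ (l + 2)) ^ (j : ℕ) = F * (2 ^ (j : ℕ)) ^ l := by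
        rw [hF, show (4 : ℤ) = 2 ^ 2 by norm_num]
        simp only [← pow_mul, ← pow_add]
        congr 1; ring
      have h3 : ((2 : ℤ) ^ (j : ℕ)) ^ l ≤ N ^ l :=
        pow_le_pow_left₀ (by positivity) (pow_le_pow_right₀ (by norm_num) j.2.le) l
      have h4 : F * (2 ^ (j : ℕ)) ^ l ≤ F * N ^ l := mul_le_mul_of_nonneg_left h3 hF0.le
      have h5 : |∑ i ∈ A, b i ^ (l + 2) - ∑ i ∈ B, b i ^ (l + 2)| ≤ (D * N + 2 * F) * N ^ l := by
        have : 0 ≤ D * N * N ^ l := by positivity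
        rw [h2] at h1
        linarith
      rw [pow_add, ← mul_assoc]
      exact mul_le_mul_of_nonneg_right h5 (by positivity)
  have he := e_diff (fun k => mthEval n k b A) (fun k => ∑ i ∈ A, b i ^ k)
    (fun k => mthEval n k b B) (fun k => ∑ i ∈ B, b i ^ k) N (D * N + 2 * F) hN.le hQ0
    (mthEval_zero _ _ _) (mthEval_zero _ _ _) (hp A) (hp B) (hn A) (hn B) hd
  obtain ⟨q, rfl⟩ : ∃ q, m = q + 2 := ⟨m - 2, by omega⟩
  set s := A.card with hs
  have hX0 : 0 < X := lt_of_lt_of_le (by positivity) hX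
  obtain ⟨Δ, hΔ⟩ : ∃ Δ : ℕ → ℤ, ∀ k, Δ k = mthEval n k b A - mthEval n k b B := ⟨_, fun _ => rfl⟩
  have hsum : mthEval n (q + 2) (fun i => X - b i) A - mthEval n (q + 2) (fun i => X - b i) B
      = ∑ k ∈ Finset.range (q + 3), (-1) ^ k * X ^ (q + 2 - k) *
        ((s - k).choose (s - (q + 2)) : ℤ) * Δ k := by
    rw [shift_aux _ _ _ _ A hA, shift_aux _ _ _ _ B (hAB ▸ hA), ← hAB, ← Finset.sum_sub_distrib]
    exact Finset.sum_congr rfl fun k _ => by rw [hΔ]; ring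
  rw [Finset.sum_range_succ', Finset.sum_range_succ', Finset.sum_range_succ'] at hsum
  have hA1 := hn A 1
  have hB1 := hn B 1
  have hA2 := hn A 2
  have hB2 := hn B 2
  simp only [Finset.sum_range_succ, Finset.sum_range_zero, mthEval_zero] at hA1 hB1 hA2 hB2
  norm_num at hA1 hB1 hA2 hB2
  have hΔ0 : Δ 0 = 0 := by rw [hΔ, mthEval_zero, mthEval_zero]; simp
  have hΔ1 : Δ 1 = D := by rw [hΔ, hA1, hB1, hD]; simp
  obtain ⟨W, hW⟩ : ∃ W, W = ∑ i ∈ A, b i ^ 1 + ∑ i ∈ B, b i ^ 1 := ⟨_, rfl⟩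
  have hΔ2 : 2 * Δ 2 = D * W - P := by
    rw [hΔ, mul_sub, hA2, hB2, hA1, hB1, hD, hW, hP]; simp only [pow_one]; ring
  have hWN : W ≤ 2 * N := by
    have h1 := (abs_le.1 (hp A 1 le_rfl)).2
    have h2 := (abs_le.1 (hp B 1 le_rfl)).2
    rw [hW]; linarith
  obtain ⟨C1, hC1⟩ : ∃ C : ℤ, C = ((s - 1).choose (s - (q + 2)) : ℤ) := ⟨_, rfl⟩
  obtain ⟨C2, hC2⟩ : ∃ C : ℤ, C = ((s - 2).choose (s - (q + 2)) : ℤ) := ⟨_, rfl⟩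
  have hC20 : 0 < C2 := by
    rw [hC2]; exact_mod_cast Nat.choose_pos (by omega)
  have hC12 : C2 ≤ C1 := by
    rw [hC1, hC2]; exact_mod_cast Nat.choose_le_choose _ (by omega)
  obtain ⟨M, hM⟩ : ∃ M : ℤ, M = 8 * ((q + 2 : ℕ) : ℤ) ^ 2 := ⟨_, rfl⟩
  have hq1 : 1 ≤ ((q + 2 : ℕ) : ℤ) ^ 2 := one_le_pow₀ (by exact_mod_cast (by omega))
  have hM1 : 1 ≤ M := by rw [hM]; linarith
  rw [← hM] at hX
  have htail : ∀ k ∈ Finset.range q, M * |(-1) ^ (k + 1 + 1 + 1) * X ^ (q + 2 - (k + 1 + 1 + 1)) *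
        ((s - (k + 1 + 1 + 1)).choose (s - (q + 2)) : ℤ) * Δ (k + 1 + 1 + 1)|
        ≤ C2 * ((q + 2 : ℕ) : ℤ) * (D * N + 2 * F) * X ^ q := by
    intro k hk
    have hk : k < q := by simpa using hk
    have h1 := he (k + 1 + 1 + 1)
    simp only [← hΔ] at h1
    have h1' : |Δ (k + 1 + 1 + 1)| ≤ ((q + 2 : ℕ) : ℤ) * (D * N + 2 * F) * N ^ (k + 1) := by
      have h0 : |Δ (k + 1 + 1 + 1)| ≤ ((k + 1 + 1 + 1 : ℕ) : ℤ) * (D * N + 2 * F) * N ^ (k + 1) := by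
        refine le_of_mul_le_mul_right (h1.trans_eq ?_) (by positivity : 0 < N ^ 2)
        ring
      refine h0.trans ?_
      have : ((k + 1 + 1 + 1 : ℕ) : ℤ) ≤ ((q + 2 : ℕ) : ℤ) := by exact_mod_cast (by omega)
      gcongr
    have h2 : ((s - (k + 1 + 1 + 1)).choose (s - (q + 2)) : ℤ) ≤ C2 := by
      rw [hC2]; exact_mod_cast Nat.choose_le_choose _ (by omega)
    have h3 : M * N ^ (k + 1) ≤ X ^ (k + 1) := by
      calc M * N ^ (k + 1) ≤ M ^ (k + 1) * N ^ (k + 1) := by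
            gcongr; exact le_self_pow₀ hM1 (by omega)
        _ = (M * N) ^ (k + 1) := by rw [mul_pow]
        _ ≤ X ^ (k + 1) := by gcongr
    simp only [abs_mul, abs_pow, abs_neg, abs_one, one_pow, one_mul, Nat.abs_cast, abs_of_pos hX0]
    calc M * (X ^ (q + 2 - (k + 1 + 1 + 1)) * ((s - (k + 1 + 1 + 1)).choose (s - (q + 2)) : ℤ) * |Δ (k + 1 + 1 + 1)|)
        ≤ M * (X ^ (q + 2 - (k + 1 + 1 + 1)) * C2 * (((q + 2 : ℕ) : ℤ) * (D * N + 2 * F) * N ^ (k + 1))) := by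
          gcongr
      _ = (C2 * ((q + 2 : ℕ) : ℤ) * (D * N + 2 * F) * X ^ (q + 2 - (k + 1 + 1 + 1))) * (M * N ^ (k + 1)) := by ring
      _ ≤ (C2 * ((q + 2 : ℕ) : ℤ) * (D * N + 2 * F) * X ^ (q + 2 - (k + 1 + 1 + 1))) * X ^ (k + 1) := by
          gcongr
      _ = C2 * ((q + 2 : ℕ) : ℤ) * (D * N + 2 * F) * X ^ q := by
          rw [mul_assoc, ← pow_add]; congr 2; omega
  obtain ⟨T, hT⟩ : ∃ T, T = ∑ k ∈ Finset.range q, (-1) ^ (k + 1 + 1 + 1) * X ^ (q + 2 - (k + 1 + 1 + 1)) *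
        ((s - (k + 1 + 1 + 1)).choose (s - (q + 2)) : ℤ) * Δ (k + 1 + 1 + 1) := ⟨_, rfl⟩
  have hTb : 8 * T ≤ C2 * (D * N + 2 * F) * X ^ q := by
    have h1 : M * T ≤ q * (C2 * ((q + 2 : ℕ) : ℤ) * (D * N + 2 * F) * X ^ q) := by
      calc M * T ≤ ∑ k ∈ Finset.range q, C2 * ((q + 2 : ℕ) : ℤ) * (D * N + 2 * F) * X ^ q := by
            rw [hT, Finset.mul_sum]
            refine Finset.sum_le_sum fun k hk => le_trans ?_ (htail k hk)
            exact mul_le_mul_of_nonneg_left (le_abs_self _) (by linarith)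
        _ = _ := by simp
    have h2 : (q : ℤ) * (C2 * ((q + 2 : ℕ) : ℤ) * (D * N + 2 * F) * X ^ q) ≤
        ((q + 2 : ℕ) : ℤ) * (C2 * ((q + 2 : ℕ) : ℤ) * (D * N + 2 * F) * X ^ q) := by
      gcongr; omega
    have h3 : (0 : ℤ) < ((q + 2 : ℕ) : ℤ) ^ 2 := by positivity
    refine le_of_mul_le_mul_left ?_ h3
    rw [hM] at h1
    calc _ = 8 * ((q + 2 : ℕ) : ℤ) ^ 2 * T := by ring
      _ ≤ _ := h1.trans h2
      _ = _ := by ring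
  rw [← hT] at hsum
  have e1 : (0 + 1 + 1 : ℕ) = 2 := rfl
  have e2 : (0 + 1 : ℕ) = 1 := rfl
  rw [e1, e2, ← hC1, ← hC2, hΔ0, hΔ1, show q + 2 - 2 = q by omega, show q + 2 - 1 = q + 1 by omega] at hsum
  have hY : 0 < X ^ q := by positivity
  have hXN : 2 * N ≤ X := by
    have : 8 * N ≤ M * N := by
      gcongr; rw [hM]; linarith
    linarith
  have hfin := final_aux X (X ^ q) N D W P F C1 C2 T (Δ 2) hY hN hD1 hC20 hC12 hXN hWN hP1 hΔ2 hTb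
  have hring : T + (-1) ^ 2 * X ^ q * C2 * Δ 2 + (-1) ^ 1 * X ^ (q + 1) * C1 * D =
      T + X ^ q * C2 * Δ 2 - X ^ q * X * C1 * D := by ring
  rw [hring, mul_zero, add_zero] at hsum
  linarith

lemma growth (ε : ℝ) (hε : 0 < ε) (m : ℕ) : ∃ n₀ : ℕ, ∀ n : ℕ, n₀ ≤ n →
    8 * (m : ℤ) ^ 2 * 2 ^ n ≤ ⌊(2 + ε) ^ n⌋ ∧ (n : ℤ) * 2 ^ n < ⌊(2 + ε) ^ n⌋ := by
  have hr : 1 < (2 + ε) / 2 := by linarith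
  have h := tendsto_pow_const_div_const_pow_of_one_lt 1 hr
  have hc : (0 : ℝ) < 1 / (8 * (m : ℝ) ^ 2 + 2) := by positivity
  have h1 := h.eventually (gt_mem_nhds hc)
  obtain ⟨n₀, hn₀⟩ := Filter.eventually_atTop.1 h1
  refine ⟨n₀ + 1, fun n hn => ?_⟩
  have h2 := hn₀ n (by omega)
  rw [pow_one, div_pow, div_lt_div_iff₀ (by positivity) (by positivity)] at h2
  have h2' : (n : ℝ) * (8 * (m : ℝ) ^ 2 + 2) * 2 ^ n < (2 + ε) ^ n := by
    have := mul_lt_mul_of_pos_right h2 (by positivity : (0 : ℝ) < 2 ^ n)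
    rwa [one_mul, div_mul_cancel₀ _ (by positivity)] at this
  have hn1 : (1 : ℝ) ≤ n := by exact_mod_cast (by omega : 1 ≤ n)
  have h3 : (8 * (m : ℝ) ^ 2 + n + 1) * 2 ^ n ≤ (2 + ε) ^ n := by
    refine le_trans ?_ h2'.le
    refine mul_le_mul_of_nonneg_right ?_ (by positivity)
    have : 0 ≤ (m : ℝ) ^ 2 := by positivity
    nlinarith
  have h4 : (8 * (m : ℤ) ^ 2 + n + 1) * 2 ^ n ≤ ⌊(2 + ε) ^ n⌋ := by
    rw [Int.le_floor]; push_cast; exact h3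
  have hp : (0 : ℤ) < 2 ^ n := by positivity
  have h5 : 0 ≤ (m : ℤ) ^ 2 * 2 ^ n := by positivity
  have h6 : 0 ≤ (n : ℤ) * 2 ^ n := by positivity
  constructor <;> linarith

theorem stmt15 (ε : ℝ) (hε : 0 < ε) (m : ℕ) (hm : 2 ≤ m) :
    ∃ n₀ : ℕ, ∀ n : ℕ, n₀ ≤ n →
      ∀ A₁ A₂ : Finset (Fin n), A₁ ≠ A₂ → m ≤ A₁.card → m ≤ A₂.card →
        mthEval n m (fun i => ⌊(2 + ε) ^ n - 2 ^ (i : ℕ)⌋) A₁ ≠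
          mthEval n m (fun i => ⌊(2 + ε) ^ n - 2 ^ (i : ℕ)⌋) A₂ := by
  obtain ⟨n₀, hn₀⟩ := growth ε hε m
  refine ⟨n₀, fun n hn A B hne hA hB => ?_⟩
  obtain ⟨hX1, hX2⟩ := hn₀ n hn
  have hfl : (fun i : Fin n => ⌊(2 + ε) ^ n - 2 ^ (i : ℕ)⌋) =
      fun i : Fin n => ⌊(2 + ε) ^ n⌋ - 2 ^ (i : ℕ) := by
    funext i
    rw [← Int.floor_sub_intCast]
    push_cast
    rfl
  rw [hfl]
  generalize ⌊(2 + ε) ^ n⌋ = X at *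
  have ha1 : ∀ i : Fin n, X - 2 ^ (i : ℕ) ≤ X := fun i => by
    have : (0 : ℤ) < 2 ^ (i : ℕ) := by positivity
    linarith
  have ha2 : ∀ i : Fin n, X - 2 ^ n ≤ X - 2 ^ (i : ℕ) := fun i => by
    have : (2 : ℤ) ^ (i : ℕ) ≤ 2 ^ n := pow_le_pow_right₀ (by norm_num) i.2.le
    linarith
  rcases lt_trichotomy A.card B.card with h | h | h
  · exact (card_case n m hm X (2 ^ n) (by positivity) hX2 _ ha1 ha2 A B hA h).ne
  · have hnon : (symmDiff A B).Nonempty := by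
      rw [Finset.nonempty_iff_ne_empty]
      intro h0
      exact hne (symmDiff_eq_bot.1 h0)
    have hmem := Finset.max'_mem _ hnon
    have hmax : ∀ i, (symmDiff A B).max' hnon < i → (i ∈ A ↔ i ∈ B) := by
      intro i hi
      by_contra hc
      have : i ∈ symmDiff A B := by rw [Finset.mem_symmDiff]; tauto
      exact absurd (Finset.le_max' _ _ this) (not_le.2 hi)
    generalize (symmDiff A B).max' hnon = j at hmem hmax
    rw [Finset.mem_symmDiff] at hmem
    rcases hmem with ⟨h1, h2⟩ | ⟨h1, h2⟩
    · exact (same_card n m hm X hX1 A B hA h j h1 h2 hmax).ne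
    · exact (same_card n m hm X hX1 B A hB h.symm j h1 h2 (fun i hi => (hmax i hi).symm)).ne'
  · exact (card_case n m hm X (2 ^ n) (by positivity) hX2 _ ha1 ha2 B A hB h).ne'
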